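/- arXiv:2103.02271 — 7 statements merged into one kernel-verified Lean document; each statement's English description precedes it below -/
import Mathlib

section
/- Let (u_k)_{k≥1} and (λ_k)_{k≥1} be nonnegative real sequences and let (S_k)_{k≥1} be a nondecreasing real sequence with S_1 ≥ u_1². If u_k² ≤ S_k + ∑_{i=1}^k λ_i u_i for all k ≥ 1, then for all k ≥ 1, u_k ≤ (1/2)∑_{i=1}^k λ_i + ( S_k + ((1/2)∑_{i=1}^k λ_i)² )^{1/2}. -/
open scoped RealInnerProductSpace
open Filter

theorem stmt_1 (u lam S : ℕ → ℝ)
    (hu : ∀ k, 1 ≤ k → 0 ≤ u k) (hlam : ∀ k, 1 ≤ k → 0 ≤ lam k)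
    (hS : ∀ k, 1 ≤ k → S k ≤ S (k + 1)) (hS1 : u 1 ^ 2 ≤ S 1)
    (hrec : ∀ k, 1 ≤ k → u k ^ 2 ≤ S k + ∑ i ∈ Finset.Icc 1 k, lam i * u i) :
    ∀ k, 1 ≤ k → u k ≤ (1 / 2) * ∑ i ∈ Finset.Icc 1 k, lam i +
      Real.sqrt (S k + ((1 / 2) * ∑ i ∈ Finset.Icc 1 k, lam i) ^ 2) := by
  intro k hk
  obtain ⟨m, hm, hmax⟩ := (Finset.Icc 1 k).exists_max_image u ⟨1, Finset.mem_Icc.2 ⟨le_rfl, hk⟩⟩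
  obtain ⟨hm1, hmk⟩ := Finset.mem_Icc.1 hm
  have hSmk : S m ≤ S k :=
    Nat.le_induction le_rfl (fun n hn ih => ih.trans (hS n (hm1.trans hn))) k hmk
  have hsum : ∑ i ∈ Finset.Icc 1 m, lam i * u i ≤ (∑ i ∈ Finset.Icc 1 k, lam i) * u m := by
    rw [Finset.sum_mul]
    calc ∑ i ∈ Finset.Icc 1 m, lam i * u i
        ≤ ∑ i ∈ Finset.Icc 1 k, lam i * u i :=
          Finset.sum_le_sum_of_subset_of_nonneg (Finset.Icc_subset_Icc_right hmk)
            fun i hi _ => mul_nonneg (hlam i (Finset.mem_Icc.1 hi).1)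
              (hu i (Finset.mem_Icc.1 hi).1)
      _ ≤ ∑ i ∈ Finset.Icc 1 k, lam i * u m :=
          Finset.sum_le_sum fun i hi =>
            mul_le_mul_of_nonneg_left (hmax i hi) (hlam i (Finset.mem_Icc.1 hi).1)
  have hsqrt : u m - (1 / 2) * ∑ i ∈ Finset.Icc 1 k, lam i ≤
      Real.sqrt (S k + ((1 / 2) * ∑ i ∈ Finset.Icc 1 k, lam i) ^ 2) :=
    Real.le_sqrt_of_sq_le (by nlinarith [hrec m hm1])
  linarith [hmax k (Finset.mem_Icc.2 ⟨hk, le_rfl⟩)]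
end

section
/- Let h : ℝⁿ → ℝ be convex, let α > 0, ε ≥ 0, and y ∈ ℝⁿ. Suppose x ∈ ℝⁿ is an ε-optimal solution of the proximal problem, i.e. (1/(2α))‖x − y‖² + h(x) ≤ ε + inf_{z ∈ ℝⁿ} [ (1/(2α))‖z − y‖² + h(z) ]. Then there exists p ∈ ℝⁿ with ‖p‖ ≤ √(2αε) such that (1/α)(y − x − p) ∈ ∂_ε h(x), i.e. for all u ∈ ℝⁿ, h(u) ≥ h(x) + ⟨(1/α)(y − x − p), u − x⟩ − ε. -/
open scoped RealInnerProductSpace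
open Filter

/-- **Sandwich theorem.** A continuous concave function lying below a convex function is separated
from it by a continuous affine function. -/
theorem exists_affine_between_of_concaveOn_of_convexOn {E : Type*} [AddCommGroup E] [Module ℝ E]
    [TopologicalSpace E] [IsTopologicalAddGroup E] [ContinuousSMul ℝ E]
    {g h : E → ℝ} (hg : ConcaveOn ℝ Set.univ g) (hgc : Continuous g)
    (hh : ConvexOn ℝ Set.univ h) (hgh : ∀ z, g z ≤ h z) :
    ∃ (l : StrongDual ℝ E) (b : ℝ), ∀ z, g z ≤ l z + b ∧ l z + b ≤ h z := by
  have hopen : IsOpen {p : E × ℝ | p.1 ∈ Set.univ ∧ p.2 < g p.1} := by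
    simpa using isOpen_lt continuous_snd (hgc.comp continuous_fst)
  have hdisj : Disjoint {p : E × ℝ | p.1 ∈ Set.univ ∧ p.2 < g p.1}
      {p : E × ℝ | p.1 ∈ Set.univ ∧ h p.1 ≤ p.2} :=
    Set.disjoint_left.2 fun p hp hq => (hp.2.trans_le ((hgh p.1).trans hq.2)).false
  obtain ⟨f, u, hlt, hle⟩ := geometric_hahn_banach_open hg.convex_strict_hypograph hopen
    hh.convex_epigraph hdisj
  have hf : ∀ z t, f (z, t) = f (z, 0) + t * f (0, 1) := fun z t => by
    rw [← smul_eq_mul, ← map_smul, ← map_add]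
    simp
  have hbelow : ∀ z t, t < g z → f (z, 0) + t * f (0, 1) < u := fun z t ht =>
    hf z t ▸ hlt (z, t) ⟨trivial, ht⟩
  have habove : ∀ z, u ≤ f (z, 0) + h z * f (0, 1) := fun z =>
    hf z (h z) ▸ hle (z, h z) ⟨trivial, le_rfl⟩
  have hk : 0 < f (0, 1) := by
    have h₁ := hbelow 0 (g 0 - 1) (by linarith)
    have h₂ := habove 0
    have h₃ := hgh 0
    by_contra! hk
    nlinarith
  refine ⟨-(f (0, 1))⁻¹ • f.comp (ContinuousLinearMap.inl ℝ E ℝ), u / f (0, 1), fun z => ?_⟩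
  have hval : (-(f (0, 1))⁻¹ • f.comp (ContinuousLinearMap.inl ℝ E ℝ)) z + u / f (0, 1)
      = (u - f (z, 0)) / f (0, 1) := by
    simp
    ring
  rw [hval]
  constructor
  · refine le_of_forall_lt fun t ht => ?_
    rw [lt_div_iff₀ hk]
    linarith [hbelow z t ht]
  · rw [div_le_iff₀ hk]
    linarith [habove z]

theorem stmt_2 (n : ℕ) (hn : 0 < n) (h : EuclideanSpace ℝ (Fin n) → ℝ)
    (hconv : ConvexOn ℝ Set.univ h) (α ε : ℝ) (hα : 0 < α) (hε : 0 ≤ ε)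
    (y x : EuclideanSpace ℝ (Fin n))
    (hopt : ∀ z, (1 / (2 * α)) * ‖x - y‖ ^ 2 + h x
      ≤ ε + ((1 / (2 * α)) * ‖z - y‖ ^ 2 + h z)) :
    ∃ p : EuclideanSpace ℝ (Fin n), ‖p‖ ≤ Real.sqrt (2 * α * ε) ∧
      ∀ u, h x + ⟪α⁻¹ • (y - x - p), u - x⟫ - ε ≤ h u := by
  have hquad : ConvexOn ℝ Set.univ fun z : EuclideanSpace ℝ (Fin n) =>
      (1 / (2 * α)) * ‖z - y‖ ^ 2 := by
    have hdist : ConvexOn ℝ Set.univ fun z : EuclideanSpace ℝ (Fin n) => ‖z - y‖ := by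
      simpa [dist_eq_norm] using convexOn_univ_dist y
    exact (hdist.pow (fun _ _ => norm_nonneg _) 2).smul (by positivity)
  obtain ⟨l, b, hl⟩ := exists_affine_between_of_concaveOn_of_convexOn
    ((concaveOn_const ((1 / (2 * α)) * ‖x - y‖ ^ 2 + h x - ε) convex_univ).sub hquad)
    (by simp only [Pi.sub_def]; fun_prop) hconv
    (fun z => by simp only [Pi.sub_apply]; linarith [hopt z])
  simp only [Pi.sub_apply] at hl
  obtain ⟨d, rfl⟩ := (InnerProductSpace.toDual ℝ (EuclideanSpace ℝ (Fin n))).surjective l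
  simp only [InnerProductSpace.toDual_apply_apply] at hl
  refine ⟨y - x - α • d, Real.le_sqrt_of_sq_le ?_, fun u => ?_⟩
  · have hz := (hl (y - α • d)).1
    have hx := (hl x).2
    obtain ⟨w, rfl⟩ : ∃ w, y = x + w := ⟨y - x, by abel⟩
    have e₁ : x - (x + w) = -w := by abel
    have e₂ : x + w - α • d - (x + w) = -(α • d) := by abel
    have e₃ : x + w - x - α • d = w - α • d := by abel
    rw [e₁, e₂, norm_neg, norm_neg, norm_smul, Real.norm_of_nonneg hα.le] at hz
    rw [e₃, norm_sub_sq_real, norm_smul, Real.norm_of_nonneg hα.le, inner_smul_right,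
      real_inner_comm]
    simp only [inner_sub_right, inner_add_right, inner_smul_right,
      real_inner_self_eq_norm_sq] at hz
    have hmain : 1 / (2 * α) * ‖w‖ ^ 2 - 1 / (2 * α) * (α * ‖d‖) ^ 2
        ≤ ⟪d, w⟫ - α * ‖d‖ ^ 2 + ε := by linarith
    have hmul := mul_le_mul_of_nonneg_left hmain (by positivity : 0 ≤ 2 * α)
    have hexp : 2 * α * (1 / (2 * α) * ‖w‖ ^ 2 - 1 / (2 * α) * (α * ‖d‖) ^ 2)
        = ‖w‖ ^ 2 - (α * ‖d‖) ^ 2 := by field_simp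
    rw [hexp] at hmul
    linarith
  · rw [sub_sub_cancel, smul_smul, inv_mul_cancel₀ hα.ne', one_smul, inner_sub_right]
    linarith [(hl x).1, (hl u).2]
end

section
/- For every k ≥ 1, the averaged iterates of the distributed proximal gradient algorithm satisfy v̄_{k+1} = x̄_k − α(∇g(x̄_k) + e_{k+1}), and x̄_{k+1} is an ε_{k+1}-inexact proximal point of v̄_{k+1}: (1/(2α))‖x̄_{k+1} − v̄_{k+1}‖² + h(x̄_{k+1}) ≤ ε_{k+1} + inf_{z ∈ ℝⁿ} [ (1/(2α))‖z − v̄_{k+1}‖² + h(z) ]. -/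
open scoped RealInnerProductSpace
open Filter

theorem ConvexOn.exists_subgradient {E : Type*} [NormedAddCommGroup E] [InnerProductSpace ℝ E]
    [FiniteDimensional ℝ E] {f : E → ℝ} (hf : ConvexOn ℝ Set.univ f) (x : E) :
    ∃ z : E, ∀ u, f x + ⟪z, u - x⟫ ≤ f u := by
  have hcont : Continuous f := continuousOn_univ.mp (hf.continuousOn isOpen_univ)
  have hopen : IsOpen {p : E × ℝ | p.1 ∈ Set.univ ∧ f p.1 < p.2} := by
    simpa using isOpen_lt (hcont.comp continuous_fst) continuous_snd
  obtain ⟨l, hl⟩ := geometric_hahn_banach_open_point hf.convex_strict_epigraph hopen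
    (x := (x, f x)) (by simp)
  have hsplit (y : E) (r : ℝ) : l (y, r) = l (y, 0) + r * l (0, 1) := by
    rw [← smul_eq_mul, ← map_smul, ← map_add]
    simp
  have hneg : l (0, 1) < 0 := by
    have := hl (x, f x + 1) (by simp)
    rw [hsplit x (f x + 1), hsplit x (f x)] at this
    linarith
  have hle (u : E) : l (u, 0) + f u * l (0, 1) ≤ l (x, 0) + f x * l (0, 1) := by
    refine le_of_forall_pos_lt_add fun δ hδ => ?_
    have := hl (u, f u + δ / -l (0, 1)) (by simpa using div_pos hδ (neg_pos.mpr hneg))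
    rw [hsplit u, hsplit x (f x)] at this
    have hcancel : δ / -l (0, 1) * l (0, 1) = -δ := by
      field_simp [hneg.ne]
    linarith
  refine ⟨(InnerProductSpace.toDual ℝ E).symm ((-l (0, 1))⁻¹ • l.comp (.inl ℝ E ℝ)), fun u => ?_⟩
  have hdiff : l (u - x, 0) = l (u, 0) - l (x, 0) := by
    rw [← map_sub]
    simp
  have hbound : (-l (0, 1))⁻¹ * l (u - x, 0) ≤ f u - f x := by
    rw [inv_mul_le_iff₀ (neg_pos.mpr hneg), hdiff]
    linarith [hle u]
  rw [InnerProductSpace.toDual_symm_apply]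
  simp only [smul_apply, ContinuousLinearMap.comp_apply, ContinuousLinearMap.inl_apply,
    smul_eq_mul]
  linarith

theorem ConvexOn.sub_le_of_norm_subgradient_le {E : Type*} [NormedAddCommGroup E]
    [InnerProductSpace ℝ E] [FiniteDimensional ℝ E] {f : E → ℝ} (hf : ConvexOn ℝ Set.univ f)
    {C : ℝ} (hC : ∀ x z : E, (∀ u, f x + ⟪z, u - x⟫ ≤ f u) → ‖z‖ ≤ C) (x y : E) :
    f x - f y ≤ ‖x - y‖ * C := by
  obtain ⟨z, hz⟩ := hf.exists_subgradient x
  calc f x - f y ≤ -⟪z, y - x⟫ := by linarith [hz y]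
    _ = ⟪z, x - y⟫ := by rw [← inner_neg_right, neg_sub]
    _ ≤ ‖z‖ * ‖x - y‖ := real_inner_le_norm _ _
    _ ≤ ‖x - y‖ * C := by
      rw [mul_comm]
      gcongr
      exact hC x z hz

theorem norm_sub_sq_le_add {E : Type*} [SeminormedAddCommGroup E] (x z v : E) :
    ‖x - v‖ ^ 2 ≤ ‖x - z‖ ^ 2 + 2 * (‖x - z‖ * ‖z - v‖) + ‖z - v‖ ^ 2 := by
  calc ‖x - v‖ ^ 2 ≤ (‖x - z‖ + ‖z - v‖) ^ 2 := by
        gcongr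
        exact norm_sub_le_norm_sub_add_norm_sub x z v
    _ = _ := by ring

theorem sum_sum_smul_of_col_sum_eq_one {ι E : Type*} [Fintype ι] [AddCommGroup E] [Module ℝ E]
    {w : ι → ι → ℝ} (hw : ∀ j, ∑ i, w i j = 1) (q : ι → E) :
    ∑ i, ∑ j, w i j • q j = ∑ j, q j := by
  rw [Finset.sum_comm]
  simp [← Finset.sum_smul, hw]

theorem stmt_3
    (n m : ℕ) (hn : 0 < n) (hm : 1 ≤ m)
    (g : Fin m → EuclideanSpace ℝ (Fin n) → ℝ)
    (G : Fin m → EuclideanSpace ℝ (Fin n) → EuclideanSpace ℝ (Fin n))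
    (L Gg Gh α : ℝ) (hL : 0 < L)
    (hgrad : ∀ i x, HasGradientAt (g i) (G i x) x)
    (hLip : ∀ i x y, ‖G i x - G i y‖ ≤ L * ‖x - y‖)
    (hGg : ∀ i x, ‖G i x‖ ≤ Gg)
    (h : EuclideanSpace ℝ (Fin n) → ℝ)
    (hconv : ConvexOn ℝ Set.univ h)
    (hGh : 0 < Gh)
    (hsub : ∀ x z : EuclideanSpace ℝ (Fin n), (∀ u, h x + ⟪z, u - x⟫ ≤ h u) → ‖z‖ ≤ Gh)
    (hα0 : 0 < α) (hα1 : α < 1 / L)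
    (prox : EuclideanSpace ℝ (Fin n) → EuclideanSpace ℝ (Fin n))
    (hprox : ∀ w z, h (prox w) + (1 / (2 * α)) * ‖prox w - w‖ ^ 2
      ≤ h z + (1 / (2 * α)) * ‖z - w‖ ^ 2)
    (hproxuniq : ∀ w z, (∀ u, h z + (1 / (2 * α)) * ‖z - w‖ ^ 2
      ≤ h u + (1 / (2 * α)) * ‖u - w‖ ^ 2) → z = prox w)
    (lam : ℕ → Fin m → Fin m → ℝ) (Γ γ : ℝ) (hΓ : 0 < Γ) (hγ0 : 0 < γ) (hγ1 : γ < 1)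
    (hlamnn : ∀ k, 2 ≤ k → ∀ i j, 0 ≤ lam k i j)
    (hrow : ∀ k, 2 ≤ k → ∀ i, ∑ j, lam k i j = 1)
    (hcol : ∀ k, 2 ≤ k → ∀ j, ∑ i, lam k i j = 1)
    (hmix : ∀ k, 2 ≤ k → ∀ i j, |lam k i j - 1 / (m : ℝ)| ≤ Γ * γ ^ k)
    (x q v : ℕ → Fin m → EuclideanSpace ℝ (Fin n))
    (hq : ∀ k, 1 ≤ k → ∀ i, q (k + 1) i = x k i - α • G i (x k i))
    (hv : ∀ k, 1 ≤ k → ∀ i, v (k + 1) i = ∑ j, lam (k + 1) i j • q (k + 1) j)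
    (hx : ∀ k, 1 ≤ k → ∀ i, x (k + 1) i = prox (v (k + 1) i))
    (xbar : ℕ → EuclideanSpace ℝ (Fin n))
    (hxbar : ∀ k, xbar k = (m : ℝ)⁻¹ • ∑ i, x k i)
    (vbar zb : ℕ → EuclideanSpace ℝ (Fin n))
    (hvbar : ∀ k, vbar k = (m : ℝ)⁻¹ • ∑ i, v k i)
    (hzb : ∀ k, zb k = prox (vbar k))
    (gradg : EuclideanSpace ℝ (Fin n) → EuclideanSpace ℝ (Fin n))
    (hgradg : ∀ y, gradg y = (m : ℝ)⁻¹ • ∑ i, G i y)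
    (e : ℕ → EuclideanSpace ℝ (Fin n))
    (he : ∀ k, 1 ≤ k → e (k + 1) = (m : ℝ)⁻¹ • ∑ i, (G i (x k i) - G i (xbar k)))
    (eps : ℕ → ℝ)
    (heps : ∀ k, 1 ≤ k → eps (k + 1) =
      ‖xbar (k + 1) - zb (k + 1)‖ * (Gh + α⁻¹ * ‖zb (k + 1) - vbar (k + 1)‖)
        + (1 / (2 * α)) * ‖xbar (k + 1) - zb (k + 1)‖ ^ 2)
    :
    ∀ k, 1 ≤ k →
      vbar (k + 1) = xbar k - α • (gradg (xbar k) + e (k + 1)) ∧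
      ∀ z, (1 / (2 * α)) * ‖xbar (k + 1) - vbar (k + 1)‖ ^ 2 + h (xbar (k + 1))
        ≤ eps (k + 1) + ((1 / (2 * α)) * ‖z - vbar (k + 1)‖ ^ 2 + h z) := by
  intro k hk
  constructor
  · rw [hvbar, Finset.sum_congr rfl fun i _ => hv k hk i,
      sum_sum_smul_of_col_sum_eq_one (hcol (k + 1) (by omega)),
      Finset.sum_congr rfl fun i _ => hq k hk i, hgradg, he k hk, ← smul_add,
      ← Finset.sum_add_distrib]
    simp only [add_sub_cancel, Finset.sum_sub_distrib, ← Finset.smul_sum]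
    rw [smul_sub, ← hxbar, smul_comm]
  · intro z
    have hmin := hprox (vbar (k + 1)) z
    rw [← hzb] at hmin
    have hlip := hconv.sub_le_of_norm_subgradient_le hsub (xbar (k + 1)) (zb (k + 1))
    have hsq := mul_le_mul_of_nonneg_left
      (norm_sub_sq_le_add (xbar (k + 1)) (zb (k + 1)) (vbar (k + 1)))
      (by positivity : 0 ≤ 1 / (2 * α))
    have hcoef : 1 / (2 * α) * (2 * (‖xbar (k + 1) - zb (k + 1)‖ * ‖zb (k + 1) - vbar (k + 1)‖))
        = ‖xbar (k + 1) - zb (k + 1)‖ * (α⁻¹ * ‖zb (k + 1) - vbar (k + 1)‖) := by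
      field_simp
    rw [mul_add, mul_add, hcoef] at hsq
    rw [heps k hk]
    linarith
end

section
/- For every k ≥ 1, the error terms of the distributed proximal gradient algorithm satisfy ‖e_{k+1}‖ ≤ (L/m) ∑_{i=1}^m ‖x_{i,k} − x̄_k‖ and ε_{k+1} ≤ (2G_h/m) ∑_{i=1}^m ‖v_{i,k+1} − v̄_{k+1}‖ + (1/(2α)) ( (1/m) ∑_{i=1}^m ‖v_{i,k+1} − v̄_{k+1}‖ )². -/
open scoped RealInnerProductSpace
open Filter

section Prox

variable {E : Type*} [NormedAddCommGroup E] [InnerProductSpace ℝ E]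

/-- A real number below `b + c * t` for every `t ∈ (0, 1]` is below `b`. -/
theorem le_of_forall_le_add_mul {a b c : ℝ}
    (hle : ∀ t : ℝ, 0 < t → t ≤ 1 → a ≤ b + c * t) : a ≤ b := by
  have hlim : Tendsto (fun t : ℝ => b + c * t) (nhdsWithin 0 (Set.Ioi 0)) (nhds b) := by
    have hcont : Continuous fun t : ℝ => b + c * t := by fun_prop
    simpa using (hcont.tendsto 0).mono_left nhdsWithin_le_nhds
  refine ge_of_tendsto hlim ?_
  filter_upwards [Ioc_mem_nhdsGT (zero_lt_one' ℝ)] with t ht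
  exact hle t ht.1 ht.2

/-- If `p` minimizes `z ↦ h z + ‖z - w‖² / (2α)` with `h` convex, then `(w - p) / α` is a
subgradient of `h` at `p`. -/
theorem subgradient_of_prox {h : E → ℝ} (hconv : ConvexOn ℝ Set.univ h) {α : ℝ} (hα : 0 < α)
    {w p : E}
    (hp : ∀ z, h p + (1 / (2 * α)) * ‖p - w‖ ^ 2 ≤ h z + (1 / (2 * α)) * ‖z - w‖ ^ 2) (u : E) :
    h p + ⟪α⁻¹ • (w - p), u - p⟫ ≤ h u := by
  refine le_of_forall_le_add_mul (c := (1 / (2 * α)) * ‖u - p‖ ^ 2) fun t ht0 ht1 => ?_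
  have hmin := hp ((1 - t) • p + t • u)
  have hcvx := hconv.2 (Set.mem_univ p) (Set.mem_univ u) (sub_nonneg.2 ht1) ht0.le (by ring)
  have hsq : ‖(1 - t) • p + t • u - w‖ ^ 2
      = ‖p - w‖ ^ 2 - 2 * t * ⟪w - p, u - p⟫ + t ^ 2 * ‖u - p‖ ^ 2 := by
    have hdecomp : (1 - t) • p + t • u - w = t • (u - p) - (w - p) := by module
    rw [hdecomp, norm_sub_sq_real, norm_smul, mul_pow, real_inner_smul_left,
      real_inner_comm, norm_sub_rev w p, Real.norm_eq_abs, sq_abs]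
    ring
  rw [hsq] at hmin
  simp only [smul_eq_mul] at hcvx
  rw [real_inner_smul_left]
  have hα2 : 1 / (2 * α) = α⁻¹ / 2 := by field_simp
  rw [hα2] at hmin ⊢
  refine le_of_mul_le_mul_left ?_ ht0
  linarith

/-- The proximal map of a convex function is nonexpansive. -/
theorem norm_prox_sub_prox_le {h : E → ℝ} (hconv : ConvexOn ℝ Set.univ h) {α : ℝ} (hα : 0 < α)
    {prox : E → E}
    (hprox : ∀ w z, h (prox w) + (1 / (2 * α)) * ‖prox w - w‖ ^ 2
      ≤ h z + (1 / (2 * α)) * ‖z - w‖ ^ 2) (a b : E) :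
    ‖prox a - prox b‖ ≤ ‖a - b‖ := by
  have ha := subgradient_of_prox hconv hα (hprox a) (prox b)
  have hb := subgradient_of_prox hconv hα (hprox b) (prox a)
  rw [real_inner_smul_left] at ha hb
  have hsum : α⁻¹ * (⟪a - prox a, prox b - prox a⟫ + ⟪b - prox b, prox a - prox b⟫) ≤ 0 := by
    linarith
  have hmono := nonpos_of_mul_nonpos_right hsum (inv_pos.2 hα)
  have hexpand : ⟪a - prox a, prox b - prox a⟫ + ⟪b - prox b, prox a - prox b⟫
      = ‖prox a - prox b‖ ^ 2 - ⟪a - b, prox a - prox b⟫ := by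
    rw [← neg_sub (prox a) (prox b), inner_neg_right, ← real_inner_self_eq_norm_sq,
      neg_add_eq_sub, ← inner_sub_left, ← inner_sub_left]
    congr 1
    abel
  have hcs := real_inner_le_norm (a - b) (prox a - prox b)
  have hnn := norm_nonneg (prox a - prox b)
  by_contra! hlt
  nlinarith [norm_nonneg (a - b)]

/-- The distance from an average to a point is at most the average distance. -/
theorem norm_average_sub_le {m : ℕ} (hm : m ≠ 0) (f : Fin m → E) (b : E) :
    ‖(m : ℝ)⁻¹ • ∑ i, f i - b‖ ≤ (m : ℝ)⁻¹ * ∑ i, ‖f i - b‖ := by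
  have hm' : (m : ℝ) ≠ 0 := Nat.cast_ne_zero.2 hm
  have heq : (m : ℝ)⁻¹ • ∑ i, f i - b = (m : ℝ)⁻¹ • ∑ i, (f i - b) := by
    rw [Finset.sum_sub_distrib, smul_sub, Finset.sum_const, Finset.card_univ, Fintype.card_fin,
      ← Nat.cast_smul_eq_nsmul ℝ, inv_smul_smul₀ hm']
  rw [heq, norm_smul, Real.norm_of_nonneg (by positivity)]
  gcongr
  exact norm_sum_le _ _

end Prox

theorem stmt_4
    (n m : ℕ) (hn : 0 < n) (hm : 1 ≤ m)
    (g : Fin m → EuclideanSpace ℝ (Fin n) → ℝ)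
    (G : Fin m → EuclideanSpace ℝ (Fin n) → EuclideanSpace ℝ (Fin n))
    (L Gg Gh α : ℝ) (hL : 0 < L)
    (hgrad : ∀ i x, HasGradientAt (g i) (G i x) x)
    (hLip : ∀ i x y, ‖G i x - G i y‖ ≤ L * ‖x - y‖)
    (hGg : ∀ i x, ‖G i x‖ ≤ Gg)
    (h : EuclideanSpace ℝ (Fin n) → ℝ)
    (hconv : ConvexOn ℝ Set.univ h)
    (hGh : 0 < Gh)
    (hsub : ∀ x z : EuclideanSpace ℝ (Fin n), (∀ u, h x + ⟪z, u - x⟫ ≤ h u) → ‖z‖ ≤ Gh)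
    (hα0 : 0 < α) (hα1 : α < 1 / L)
    (prox : EuclideanSpace ℝ (Fin n) → EuclideanSpace ℝ (Fin n))
    (hprox : ∀ w z, h (prox w) + (1 / (2 * α)) * ‖prox w - w‖ ^ 2
      ≤ h z + (1 / (2 * α)) * ‖z - w‖ ^ 2)
    (hproxuniq : ∀ w z, (∀ u, h z + (1 / (2 * α)) * ‖z - w‖ ^ 2
      ≤ h u + (1 / (2 * α)) * ‖u - w‖ ^ 2) → z = prox w)
    (lam : ℕ → Fin m → Fin m → ℝ) (Γ γ : ℝ) (hΓ : 0 < Γ) (hγ0 : 0 < γ) (hγ1 : γ < 1)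
    (hlamnn : ∀ k, 2 ≤ k → ∀ i j, 0 ≤ lam k i j)
    (hrow : ∀ k, 2 ≤ k → ∀ i, ∑ j, lam k i j = 1)
    (hcol : ∀ k, 2 ≤ k → ∀ j, ∑ i, lam k i j = 1)
    (hmix : ∀ k, 2 ≤ k → ∀ i j, |lam k i j - 1 / (m : ℝ)| ≤ Γ * γ ^ k)
    (x q v : ℕ → Fin m → EuclideanSpace ℝ (Fin n))
    (hq : ∀ k, 1 ≤ k → ∀ i, q (k + 1) i = x k i - α • G i (x k i))
    (hv : ∀ k, 1 ≤ k → ∀ i, v (k + 1) i = ∑ j, lam (k + 1) i j • q (k + 1) j)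
    (hx : ∀ k, 1 ≤ k → ∀ i, x (k + 1) i = prox (v (k + 1) i))
    (xbar : ℕ → EuclideanSpace ℝ (Fin n))
    (hxbar : ∀ k, xbar k = (m : ℝ)⁻¹ • ∑ i, x k i)
    (vbar zb : ℕ → EuclideanSpace ℝ (Fin n))
    (hvbar : ∀ k, vbar k = (m : ℝ)⁻¹ • ∑ i, v k i)
    (hzb : ∀ k, zb k = prox (vbar k))
    (gradg : EuclideanSpace ℝ (Fin n) → EuclideanSpace ℝ (Fin n))
    (hgradg : ∀ y, gradg y = (m : ℝ)⁻¹ • ∑ i, G i y)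
    (e : ℕ → EuclideanSpace ℝ (Fin n))
    (he : ∀ k, 1 ≤ k → e (k + 1) = (m : ℝ)⁻¹ • ∑ i, (G i (x k i) - G i (xbar k)))
    (eps : ℕ → ℝ)
    (heps : ∀ k, 1 ≤ k → eps (k + 1) =
      ‖xbar (k + 1) - zb (k + 1)‖ * (Gh + α⁻¹ * ‖zb (k + 1) - vbar (k + 1)‖)
        + (1 / (2 * α)) * ‖xbar (k + 1) - zb (k + 1)‖ ^ 2)
    :
    ∀ k, 1 ≤ k →
      ‖e (k + 1)‖ ≤ (L / m) * ∑ i, ‖x k i - xbar k‖ ∧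
      eps (k + 1) ≤ (2 * Gh / m) * ∑ i, ‖v (k + 1) i - vbar (k + 1)‖
        + (1 / (2 * α)) * ((m : ℝ)⁻¹ * ∑ i, ‖v (k + 1) i - vbar (k + 1)‖) ^ 2 := by
  intro k hk
  have hm0 : m ≠ 0 := by omega
  constructor
  · have havg := norm_average_sub_le hm0 (fun i => G i (x k i) - G i (xbar k)) 0
    simp only [sub_zero] at havg
    rw [he k hk]
    refine havg.trans ?_
    rw [div_eq_inv_mul, mul_assoc, Finset.mul_sum Finset.univ _ L]
    gcongr with i
    exact hLip i _ _
  · set D := (m : ℝ)⁻¹ * ∑ i, ‖v (k + 1) i - vbar (k + 1)‖ with hD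
    have hdist : ‖xbar (k + 1) - zb (k + 1)‖ ≤ D := by
      rw [hxbar]
      refine (norm_average_sub_le hm0 _ _).trans ?_
      rw [hD]
      gcongr with i
      rw [hx k hk, hzb]
      exact norm_prox_sub_prox_le hconv hα0 hprox _ _
    have hbound : α⁻¹ * ‖zb (k + 1) - vbar (k + 1)‖ ≤ Gh := by
      have hle := hsub _ _ (subgradient_of_prox hconv hα0 (hprox (vbar (k + 1))))
      rwa [norm_smul, Real.norm_of_nonneg (by positivity), ← hzb, norm_sub_rev] at hle
    have hrhs : (2 * Gh / m) * ∑ i, ‖v (k + 1) i - vbar (k + 1)‖ = D * (Gh + Gh) := by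
      rw [hD]
      ring
    rw [heps k hk, hrhs]
    gcongr
end

section
/- For every k ≥ 2, the iterates of the distributed proximal gradient algorithm satisfy ∑_{i=1}^m ‖q_{i,k+1}‖ ≤ ∑_{i=1}^m ‖q_{i,k}‖ + α m (G_g + G_h). -/
open scoped RealInnerProductSpace
open Filter

/-- If `p` minimizes `z ↦ h z + (1 / (2 * α)) * ‖z - w‖ ^ 2` for a convex function `h`, then
`α⁻¹ • (w - p)` is a subgradient of `h` at `p`. -/
theorem subgradient_of_isMinimizer_prox {E : Type*} [NormedAddCommGroup E] [InnerProductSpace ℝ E]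
    {h : E → ℝ} (hconv : ConvexOn ℝ Set.univ h) {α : ℝ} (hα : 0 < α) {w p : E}
    (hmin : ∀ z, h p + (1 / (2 * α)) * ‖p - w‖ ^ 2 ≤ h z + (1 / (2 * α)) * ‖z - w‖ ^ 2) (u : E) :
    h p + ⟪α⁻¹ • (w - p), u - p⟫ ≤ h u := by
  have hsegment : ∀ t : ℝ, 0 < t → t ≤ 1 →
      0 ≤ (h u - h p - ⟪α⁻¹ • (w - p), u - p⟫) + t * ((1 / (2 * α)) * ‖u - p‖ ^ 2) := by
    intro t ht0 ht1
    have hle : h ((1 - t) • p + t • u) ≤ (1 - t) * h p + t * h u :=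
      hconv.2 (Set.mem_univ p) (Set.mem_univ u) (by linarith) ht0.le (by ring)
    have hnorm : ‖(1 - t) • p + t • u - w‖ ^ 2
        = ‖p - w‖ ^ 2 - 2 * t * ⟪w - p, u - p⟫ + t ^ 2 * ‖u - p‖ ^ 2 := by
      have hz : (1 - t) • p + t • u - w = (p - w) + t • (u - p) := by module
      rw [hz, norm_add_sq_real, inner_smul_right, norm_smul, mul_pow, Real.norm_eq_abs, sq_abs,
        ← neg_sub w p, inner_neg_left]
      ring
    have hm := hmin ((1 - t) • p + t • u)
    rw [hnorm] at hm
    have hc : (1 / (2 * α)) * (2 * t * ⟪w - p, u - p⟫) = t * (α⁻¹ * ⟪w - p, u - p⟫) := by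
      field_simp
    rw [real_inner_smul_left]
    refine nonneg_of_mul_nonneg_right (a := t) ?_ ht0
    linarith
  by_contra! hlt
  set a := h u - h p - ⟪α⁻¹ • (w - p), u - p⟫ with ha
  set b := (1 / (2 * α)) * ‖u - p‖ ^ 2 with hb
  have ha0 : a < 0 := by linarith
  have hb0 : 0 ≤ b := by positivity
  have hba : 0 < b - a := by linarith
  have key := hsegment (-a / (b - a)) (div_pos (by linarith) hba)
    ((div_le_one hba).2 (by linarith))
  have hneg : a + -a / (b - a) * b = -(a ^ 2 / (b - a)) := by
    field_simp
    ring
  have hpos : 0 < a ^ 2 / (b - a) := div_pos (by nlinarith) hba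
  linarith

/-- Averaging vectors with nonnegative column-stochastic weights does not increase the sum of the
norms. -/
theorem sum_norm_sum_smul_le {ι E : Type*} [Fintype ι] [NormedAddCommGroup E] [NormedSpace ℝ E]
    {A : ι → ι → ℝ} (hA : ∀ i j, 0 ≤ A i j) (hcol : ∀ j, ∑ i, A i j = 1) (q : ι → E) :
    ∑ i, ‖∑ j, A i j • q j‖ ≤ ∑ j, ‖q j‖ := by
  calc ∑ i, ‖∑ j, A i j • q j‖ ≤ ∑ i, ∑ j, A i j * ‖q j‖ := by
        refine Finset.sum_le_sum fun i _ => (norm_sum_le _ _).trans_eq ?_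
        exact Finset.sum_congr rfl fun j _ => by
          rw [norm_smul, Real.norm_of_nonneg (hA i j)]
    _ = ∑ j, ‖q j‖ := by
        rw [Finset.sum_comm]
        simp_rw [← Finset.sum_mul, hcol, one_mul]

theorem stmt_5
    (n m : ℕ) (hn : 0 < n) (hm : 1 ≤ m)
    (g : Fin m → EuclideanSpace ℝ (Fin n) → ℝ)
    (G : Fin m → EuclideanSpace ℝ (Fin n) → EuclideanSpace ℝ (Fin n))
    (L Gg Gh α : ℝ) (hL : 0 < L)
    (hgrad : ∀ i x, HasGradientAt (g i) (G i x) x)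
    (hLip : ∀ i x y, ‖G i x - G i y‖ ≤ L * ‖x - y‖)
    (hGg : ∀ i x, ‖G i x‖ ≤ Gg)
    (h : EuclideanSpace ℝ (Fin n) → ℝ)
    (hconv : ConvexOn ℝ Set.univ h)
    (hGh : 0 < Gh)
    (hsub : ∀ x z : EuclideanSpace ℝ (Fin n), (∀ u, h x + ⟪z, u - x⟫ ≤ h u) → ‖z‖ ≤ Gh)
    (hα0 : 0 < α) (hα1 : α < 1 / L)
    (prox : EuclideanSpace ℝ (Fin n) → EuclideanSpace ℝ (Fin n))
    (hprox : ∀ w z, h (prox w) + (1 / (2 * α)) * ‖prox w - w‖ ^ 2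
      ≤ h z + (1 / (2 * α)) * ‖z - w‖ ^ 2)
    (hproxuniq : ∀ w z, (∀ u, h z + (1 / (2 * α)) * ‖z - w‖ ^ 2
      ≤ h u + (1 / (2 * α)) * ‖u - w‖ ^ 2) → z = prox w)
    (lam : ℕ → Fin m → Fin m → ℝ) (Γ γ : ℝ) (hΓ : 0 < Γ) (hγ0 : 0 < γ) (hγ1 : γ < 1)
    (hlamnn : ∀ k, 2 ≤ k → ∀ i j, 0 ≤ lam k i j)
    (hrow : ∀ k, 2 ≤ k → ∀ i, ∑ j, lam k i j = 1)
    (hcol : ∀ k, 2 ≤ k → ∀ j, ∑ i, lam k i j = 1)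
    (hmix : ∀ k, 2 ≤ k → ∀ i j, |lam k i j - 1 / (m : ℝ)| ≤ Γ * γ ^ k)
    (x q v : ℕ → Fin m → EuclideanSpace ℝ (Fin n))
    (hq : ∀ k, 1 ≤ k → ∀ i, q (k + 1) i = x k i - α • G i (x k i))
    (hv : ∀ k, 1 ≤ k → ∀ i, v (k + 1) i = ∑ j, lam (k + 1) i j • q (k + 1) j)
    (hx : ∀ k, 1 ≤ k → ∀ i, x (k + 1) i = prox (v (k + 1) i))
    :
    ∀ k, 2 ≤ k →
      ∑ i, ‖q (k + 1) i‖ ≤ ∑ i, ‖q k i‖ + α * m * (Gg + Gh) := by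
  intro k hk
  have hproxdist : ∀ w, ‖prox w - w‖ ≤ α * Gh := by
    intro w
    have hz := hsub (prox w) (α⁻¹ • (w - prox w))
      (subgradient_of_isMinimizer_prox hconv hα0 (hprox w))
    rw [norm_smul, norm_inv, Real.norm_of_nonneg hα0.le, inv_mul_le_iff₀ hα0] at hz
    rwa [norm_sub_rev]
  have hstep : ∀ i, ‖q (k + 1) i‖ ≤ ‖∑ j, lam k i j • q k j‖ + α * (Gg + Gh) := by
    intro i
    obtain ⟨l, rfl⟩ : ∃ l, k = l + 1 := ⟨k - 1, by omega⟩
    rw [hq (l + 1) (by omega), ← hv l (by omega)]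
    have hdist := hproxdist (v (l + 1) i)
    rw [← hx l (by omega)] at hdist
    have hgradstep : ‖α • G i (x (l + 1) i)‖ ≤ α * Gg := by
      rw [norm_smul, Real.norm_of_nonneg hα0.le]
      exact mul_le_mul_of_nonneg_left (hGg _ _) hα0.le
    have hsub_le := norm_sub_le (x (l + 1) i) (α • G i (x (l + 1) i))
    have htri := norm_le_norm_add_norm_sub' (x (l + 1) i) (v (l + 1) i)
    linarith
  calc ∑ i, ‖q (k + 1) i‖ ≤ ∑ i, (‖∑ j, lam k i j • q k j‖ + α * (Gg + Gh)) :=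
        Finset.sum_le_sum fun i _ => hstep i
    _ = ∑ i, ‖∑ j, lam k i j • q k j‖ + α * m * (Gg + Gh) := by
        rw [Finset.sum_add_distrib, Finset.sum_const, Finset.card_univ, Fintype.card_fin,
          nsmul_eq_mul]
        ring
    _ ≤ ∑ i, ‖q k i‖ + α * m * (Gg + Gh) :=
        add_le_add_left (sum_norm_sum_smul_le (hlamnn k hk) (hcol k hk) (q k)) _
end

section
/- For every k ≥ 2 and every agent i ∈ {1,…,m}, the iterates of the distributed proximal gradient algorithm satisfy ‖x_{i,k} − x̄_k‖ ≤ 2Γ γ^k ∑_{j=1}^m ‖q_{j,k}‖, where x̄_k = (1/m)∑_{j=1}^m x_{j,k}. -/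
open scoped RealInnerProductSpace
open Filter

section Proximal

variable {E : Type*} [NormedAddCommGroup E] [InnerProductSpace ℝ E] {h : E → ℝ} {c : ℝ}

/-- First-order inequality for a minimizer `p` of `z ↦ h z + c * ‖z - w‖ ^ 2`, obtained by
comparing `p` with the point at parameter `t` on the segment from `p` to `z`. -/
lemma prox_variational_ineq (hconv : ConvexOn ℝ Set.univ h) {p w : E}
    (hp : ∀ z, h p + c * ‖p - w‖ ^ 2 ≤ h z + c * ‖z - w‖ ^ 2) (z : E) {t : ℝ}
    (ht0 : 0 < t) (ht1 : t ≤ 1) :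
    0 ≤ h z - h p + 2 * c * ⟪p - w, z - p⟫ + c * t * ‖z - p‖ ^ 2 := by
  have hmin := hp ((1 - t) • p + t • z)
  have hcv := hconv.2 (Set.mem_univ p) (Set.mem_univ z) (sub_nonneg.2 ht1) ht0.le (by ring)
  have hexp : ‖(1 - t) • p + t • z - w‖ ^ 2
      = ‖p - w‖ ^ 2 + 2 * (t * ⟪p - w, z - p⟫) + t ^ 2 * ‖z - p‖ ^ 2 := by
    have hseg : (1 - t) • p + t • z - w = (p - w) + t • (z - p) := by module
    rw [hseg, norm_add_sq_real, real_inner_smul_right, norm_smul, mul_pow, Real.norm_eq_abs,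
      sq_abs]
  rw [hexp] at hmin
  simp only [smul_eq_mul] at hcv
  refine nonneg_of_mul_nonneg_right ?_ ht0
  linarith

/-- The proximal operator of a convex function is nonexpansive. -/
lemma norm_prox_sub_le (hconv : ConvexOn ℝ Set.univ h) (hc : 0 < c) {p p' w w' : E}
    (hp : ∀ z, h p + c * ‖p - w‖ ^ 2 ≤ h z + c * ‖z - w‖ ^ 2)
    (hp' : ∀ z, h p' + c * ‖p' - w'‖ ^ 2 ≤ h z + c * ‖z - w'‖ ^ 2) :
    ‖p - p'‖ ≤ ‖w - w'‖ := by
  by_contra! hlt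
  have hd : 0 < ‖p - p'‖ := (norm_nonneg _).trans_lt hlt
  have hkey : ∀ t : ℝ, 0 < t → t ≤ 1 → (1 - t) * ‖p - p'‖ ≤ ‖w - w'‖ := by
    intro t ht0 ht1
    have h₁ := prox_variational_ineq hconv hp p' ht0 ht1
    have h₂ := prox_variational_ineq hconv hp' p ht0 ht1
    rw [norm_sub_rev p' p] at h₁
    have hinner : ⟪p - w, p' - p⟫ + ⟪p' - w', p - p'⟫
        = ⟪w - w', p - p'⟫ - ‖p - p'‖ ^ 2 := by
      rw [← neg_sub p p', inner_neg_right, ← real_inner_self_eq_norm_sq, neg_add_eq_sub,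
        ← inner_sub_left, ← inner_sub_left]
      congr 1
      abel
    have hmono : 0 ≤ ⟪w - w', p - p'⟫ - (1 - t) * ‖p - p'‖ ^ 2 := by
      refine nonneg_of_mul_nonneg_right (a := 2 * c) ?_ (by positivity)
      linear_combination h₁ + h₂ + 2 * c * hinner
    have hcs := real_inner_le_norm (w - w') (p - p')
    refine le_of_mul_le_mul_right ?_ hd
    linarith
  have hhalf := hkey ((‖p - p'‖ - ‖w - w'‖) / (2 * ‖p - p'‖))
    (div_pos (sub_pos.2 hlt) (by positivity))
    ((div_le_one (by positivity)).2 (by linarith [norm_nonneg (w - w')]))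
  have hcancel : (‖p - p'‖ - ‖w - w'‖) / (2 * ‖p - p'‖) * ‖p - p'‖
      = (‖p - p'‖ - ‖w - w'‖) / 2 := by
    field_simp
  linarith

end Proximal

section Averages

variable {ι E : Type*} [Fintype ι] [NormedAddCommGroup E] [NormedSpace ℝ E]

/-- Two linear combinations whose coefficients are all within `ε` of a common value `c` differ by
at most `2 * ε` times the sum of the norms. -/
lemma norm_sum_smul_sub_sum_smul_le {a b : ι → ℝ} {c ε : ℝ} (ha : ∀ j, |a j - c| ≤ ε)
    (hb : ∀ j, |b j - c| ≤ ε) (q : ι → E) :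
    ‖∑ j, a j • q j - ∑ j, b j • q j‖ ≤ 2 * ε * ∑ j, ‖q j‖ := by
  rw [← Finset.sum_sub_distrib, Finset.mul_sum]
  refine norm_sum_le_of_le _ fun j _ => ?_
  rw [← sub_smul, norm_smul, Real.norm_eq_abs]
  gcongr
  have htri := abs_sub_le (a j) c (b j)
  rw [abs_sub_comm c] at htri
  linarith [ha j, hb j]

/-- A point within distance `B` of every member of a finite family is within distance `B` of its
average. -/
lemma norm_sub_average_le [Nonempty ι] {x : ι → E} {y : E} {B : ℝ}
    (hB : ∀ j, ‖y - x j‖ ≤ B) : ‖y - (Fintype.card ι : ℝ)⁻¹ • ∑ j, x j‖ ≤ B := by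
  have hcard : (0 : ℝ) < Fintype.card ι := by exact_mod_cast Fintype.card_pos
  have havg : y - (Fintype.card ι : ℝ)⁻¹ • ∑ j, x j
      = (Fintype.card ι : ℝ)⁻¹ • ∑ j, (y - x j) := by
    rw [Finset.sum_sub_distrib, Finset.sum_const, Finset.card_univ, smul_sub,
      ← Nat.cast_smul_eq_nsmul ℝ, inv_smul_smul₀ hcard.ne']
  rw [havg, norm_smul, norm_inv, Real.norm_of_nonneg hcard.le, inv_mul_le_iff₀ hcard]
  simpa using norm_sum_le_of_le Finset.univ fun j _ => hB j

end Averages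

theorem stmt_7
    (n m : ℕ) (hn : 0 < n) (hm : 1 ≤ m)
    (g : Fin m → EuclideanSpace ℝ (Fin n) → ℝ)
    (G : Fin m → EuclideanSpace ℝ (Fin n) → EuclideanSpace ℝ (Fin n))
    (L Gg Gh α : ℝ) (hL : 0 < L)
    (hgrad : ∀ i x, HasGradientAt (g i) (G i x) x)
    (hLip : ∀ i x y, ‖G i x - G i y‖ ≤ L * ‖x - y‖)
    (hGg : ∀ i x, ‖G i x‖ ≤ Gg)
    (h : EuclideanSpace ℝ (Fin n) → ℝ)
    (hconv : ConvexOn ℝ Set.univ h)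
    (hGh : 0 < Gh)
    (hsub : ∀ x z : EuclideanSpace ℝ (Fin n), (∀ u, h x + ⟪z, u - x⟫ ≤ h u) → ‖z‖ ≤ Gh)
    (hα0 : 0 < α) (hα1 : α < 1 / L)
    (prox : EuclideanSpace ℝ (Fin n) → EuclideanSpace ℝ (Fin n))
    (hprox : ∀ w z, h (prox w) + (1 / (2 * α)) * ‖prox w - w‖ ^ 2
      ≤ h z + (1 / (2 * α)) * ‖z - w‖ ^ 2)
    (hproxuniq : ∀ w z, (∀ u, h z + (1 / (2 * α)) * ‖z - w‖ ^ 2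
      ≤ h u + (1 / (2 * α)) * ‖u - w‖ ^ 2) → z = prox w)
    (lam : ℕ → Fin m → Fin m → ℝ) (Γ γ : ℝ) (hΓ : 0 < Γ) (hγ0 : 0 < γ) (hγ1 : γ < 1)
    (hlamnn : ∀ k, 2 ≤ k → ∀ i j, 0 ≤ lam k i j)
    (hrow : ∀ k, 2 ≤ k → ∀ i, ∑ j, lam k i j = 1)
    (hcol : ∀ k, 2 ≤ k → ∀ j, ∑ i, lam k i j = 1)
    (hmix : ∀ k, 2 ≤ k → ∀ i j, |lam k i j - 1 / (m : ℝ)| ≤ Γ * γ ^ k)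
    (x q v : ℕ → Fin m → EuclideanSpace ℝ (Fin n))
    (hq : ∀ k, 1 ≤ k → ∀ i, q (k + 1) i = x k i - α • G i (x k i))
    (hv : ∀ k, 1 ≤ k → ∀ i, v (k + 1) i = ∑ j, lam (k + 1) i j • q (k + 1) j)
    (hx : ∀ k, 1 ≤ k → ∀ i, x (k + 1) i = prox (v (k + 1) i))
    (xbar : ℕ → EuclideanSpace ℝ (Fin n))
    (hxbar : ∀ k, xbar k = (m : ℝ)⁻¹ • ∑ i, x k i)
    :
    ∀ k, 2 ≤ k → ∀ i, ‖x k i - xbar k‖ ≤ 2 * Γ * γ ^ k * ∑ j, ‖q k j‖ := by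
  intro k hk i
  obtain ⟨k, rfl⟩ : ∃ l, k = l + 1 := ⟨k - 1, by omega⟩
  have hk1 : 1 ≤ k := by omega
  have : Nonempty (Fin m) := ⟨i⟩
  have hpair : ∀ j, ‖x (k + 1) i - x (k + 1) j‖
      ≤ 2 * Γ * γ ^ (k + 1) * ∑ l, ‖q (k + 1) l‖ := by
    intro j
    rw [hx k hk1, hx k hk1]
    refine (norm_prox_sub_le hconv (by positivity) (hprox _) (hprox _)).trans ?_
    rw [hv k hk1, hv k hk1, mul_assoc 2 Γ]
    exact norm_sum_smul_sub_sum_smul_le (hmix _ hk i) (hmix _ hk j) _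
  simpa [hxbar] using norm_sub_average_le hpair
end

section
/- The error sequences of the distributed proximal gradient algorithm are summable: ∑_{k=1}^∞ ‖e_{k+1}‖ < ∞, ∑_{k=1}^∞ ε_{k+1} < ∞, and ∑_{k=1}^∞ √(ε_{k+1}) < ∞. -/
open scoped RealInnerProductSpace
open Filter

section Prox

variable {E : Type*} [NormedAddCommGroup E] [InnerProductSpace ℝ E]

/-- First-order optimality: if `p` minimizes `h + ‖· - w‖² / (2α)`, then `(w - p) / α` is a
subgradient of `h` at `p`. -/
theorem subgradient_of_prox_minimizer {h : E → ℝ} (hconv : ConvexOn ℝ Set.univ h) {α : ℝ}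
    {w p : E}
    (hp : ∀ z, h p + (1 / (2 * α)) * ‖p - w‖ ^ 2 ≤ h z + (1 / (2 * α)) * ‖z - w‖ ^ 2) (u : E) :
    h p + ⟪α⁻¹ • (w - p), u - p⟫ ≤ h u := by
  have key : ∀ t ∈ Set.Ioo (0 : ℝ) 1,
      h p + ⟪α⁻¹ • (w - p), u - p⟫ ≤ h u + t * (1 / (2 * α) * ‖u - p‖ ^ 2) := by
    rintro t ⟨ht0, ht1⟩
    have hmin := hp ((1 - t) • p + t • u)
    have hc := hconv.2 (Set.mem_univ p) (Set.mem_univ u) (sub_nonneg.2 ht1.le) ht0.le (by ring)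
    have hexp : ‖(1 - t) • p + t • u - w‖ ^ 2
        = ‖p - w‖ ^ 2 - 2 * t * ⟪w - p, u - p⟫ + t ^ 2 * ‖u - p‖ ^ 2 := by
      have : (1 - t) • p + t • u - w = (p - w) + t • (u - p) := by module
      rw [this, norm_add_sq_real, inner_smul_right, norm_smul, mul_pow, Real.norm_eq_abs, sq_abs,
        ← neg_sub w p, inner_neg_left]
      ring
    rw [hexp] at hmin
    simp only [smul_eq_mul] at hc
    rw [real_inner_smul_left]
    have hα : 1 / (2 * α) * (2 * t * ⟪w - p, u - p⟫) = t * (α⁻¹ * ⟪w - p, u - p⟫) := by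
      rw [one_div, mul_inv]
      ring
    refine le_of_mul_le_mul_left ?_ ht0
    linear_combination hmin + hc - hα
  have hlim : Tendsto (fun t : ℝ => h u + t * (1 / (2 * α) * ‖u - p‖ ^ 2))
      (nhdsWithin 0 (Set.Ioi 0)) (nhds (h u)) := by
    have : Continuous fun t : ℝ => h u + t * (1 / (2 * α) * ‖u - p‖ ^ 2) := by fun_prop
    simpa using (this.tendsto 0).mono_left nhdsWithin_le_nhds
  refine ge_of_tendsto hlim ?_
  filter_upwards [Ioo_mem_nhdsGT one_pos] with t ht using key t ht

/-- Two points whose scaled residuals are subgradients are no farther apart than their centres. -/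
theorem norm_sub_le_of_subgradient {h : E → ℝ} {α : ℝ} (hα : 0 < α) {w w' p p' : E}
    (hp : ∀ u, h p + ⟪α⁻¹ • (w - p), u - p⟫ ≤ h u)
    (hp' : ∀ u, h p' + ⟪α⁻¹ • (w' - p'), u - p'⟫ ≤ h u) :
    ‖p - p'‖ ≤ ‖w - w'‖ := by
  have h₁ := hp p'
  have h₂ := hp' p
  rw [real_inner_smul_left] at h₁ h₂
  have hsum : α⁻¹ * (⟪w - p, p' - p⟫ + ⟪w' - p', p - p'⟫) ≤ 0 := by linarith
  have hle : ⟪w - p, p' - p⟫ + ⟪w' - p', p - p'⟫ ≤ 0 :=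
    nonpos_of_mul_nonpos_right hsum (inv_pos.2 hα)
  have hid : ⟪w - p, p' - p⟫ + ⟪w' - p', p - p'⟫ = ‖p - p'‖ ^ 2 - ⟪w - w', p - p'⟫ := by
    rw [← neg_sub p p', inner_neg_right, ← real_inner_self_eq_norm_sq]
    simp only [inner_sub_left]
    ring
  have hcs := real_inner_le_norm (w - w') (p - p')
  by_contra! hlt
  nlinarith [norm_nonneg (w - w')]

end Prox

section Average

variable {E : Type*} [NormedAddCommGroup E] [NormedSpace ℝ E] {m : ℕ}

theorem norm_inv_smul_sum_le (hm : 1 ≤ m) {y : Fin m → E} {d : ℝ} (hy : ∀ i, ‖y i‖ ≤ d) :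
    ‖(m : ℝ)⁻¹ • ∑ i, y i‖ ≤ d := by
  have hm0 : (0 : ℝ) < m := by exact_mod_cast hm
  rw [norm_smul, norm_inv, Real.norm_of_nonneg hm0.le, inv_mul_le_iff₀ hm0]
  simpa using norm_sum_le_of_le Finset.univ fun i _ => hy i

theorem inv_smul_sum_sub (hm : 1 ≤ m) (y : Fin m → E) (z : E) :
    (m : ℝ)⁻¹ • ∑ i, y i - z = (m : ℝ)⁻¹ • ∑ i, (y i - z) := by
  have hm0 : (m : ℝ) ≠ 0 := by positivity
  rw [Finset.sum_sub_distrib, smul_sub, Finset.sum_const, Finset.card_univ, Fintype.card_fin,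
    ← Nat.cast_smul_eq_nsmul ℝ, inv_smul_smul₀ hm0]

theorem norm_weighted_sum_le {c : Fin m → ℝ} (hc : ∀ j, 0 ≤ c j) (hsum : ∑ j, c j = 1)
    {y : Fin m → E} {d : ℝ} (hy : ∀ j, ‖y j‖ ≤ d) : ‖∑ j, c j • y j‖ ≤ d :=
  calc ‖∑ j, c j • y j‖ ≤ ∑ j, c j * d := norm_sum_le_of_le _ fun j _ => by
        rw [norm_smul, Real.norm_of_nonneg (hc j)]
        exact mul_le_mul_of_nonneg_left (hy j) (hc j)
    _ = d := by rw [← Finset.sum_mul, hsum, one_mul]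

/-- Mixing with nearly uniform weights of unit column sums brings vectors close to the average. -/
theorem norm_mix_sub_average_le {c : Fin m → Fin m → ℝ} {δ : ℝ}
    (hcol : ∀ j, ∑ i, c i j = 1) (hδ : ∀ i j, |c i j - 1 / (m : ℝ)| ≤ δ)
    {y : Fin m → E} {d : ℝ} (hy : ∀ j, ‖y j‖ ≤ d) (i : Fin m) :
    ‖∑ j, c i j • y j - (m : ℝ)⁻¹ • ∑ l, ∑ j, c l j • y j‖ ≤ m * (δ * d) := by
  have hid : ∑ j, c i j • y j - (m : ℝ)⁻¹ • ∑ l, ∑ j, c l j • y j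
      = ∑ j, (c i j - 1 / (m : ℝ)) • y j := by
    rw [Finset.sum_comm]
    simp_rw [← Finset.sum_smul, hcol, one_smul, sub_smul, one_div]
    rw [Finset.sum_sub_distrib, Finset.smul_sum]
  rw [hid]
  have := norm_sum_le_of_le (Finset.univ : Finset (Fin m))
    (f := fun j => (c i j - 1 / (m : ℝ)) • y j) (n := fun _ => δ * d) fun j _ => by
      rw [norm_smul]
      exact mul_le_mul (hδ i j) (hy j) (norm_nonneg _) ((abs_nonneg _).trans (hδ i j))
  simpa using this

end Average

/-- A linear polynomial times a decaying geometric sequence is dominated by a slower one. -/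
theorem exists_geometric_bound (A B : ℝ) {γ : ℝ} (hγ0 : 0 < γ) (hγ1 : γ < 1) :
    ∃ C r : ℝ, 0 ≤ C ∧ 0 < r ∧ r < 1 ∧ ∀ k : ℕ, γ ^ k * (A + k * B) ≤ C * r ^ k := by
  have hr0 : 0 < √γ := Real.sqrt_pos.2 hγ0
  have hr1 : √γ < 1 := by rw [Real.sqrt_lt' one_pos]; simpa
  have hlim : Tendsto (fun k : ℕ => A * √γ ^ k + B * (k * √γ ^ k)) atTop
      (nhds (A * 0 + B * 0)) :=
    ((tendsto_pow_atTop_nhds_zero_of_lt_one hr0.le hr1).const_mul A).add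
      ((tendsto_self_mul_const_pow_of_lt_one hr0.le hr1).const_mul B)
  obtain ⟨C, hC⟩ := hlim.bddAbove_range
  refine ⟨max C 0, √γ, le_max_right _ _, hr0, hr1, fun k => ?_⟩
  have hk : A * √γ ^ k + B * (k * √γ ^ k) ≤ max C 0 :=
    (hC ⟨k, rfl⟩).trans (le_max_left _ _)
  calc γ ^ k * (A + k * B) = (A * √γ ^ k + B * (k * √γ ^ k)) * √γ ^ k := by
        conv_lhs => rw [← Real.mul_self_sqrt hγ0.le, mul_pow]
        ring
    _ ≤ max C 0 * √γ ^ k := mul_le_mul_of_nonneg_right hk (by positivity)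

theorem summable_and_summable_sqrt_of_le_geometric {f : ℕ → ℝ} {C r : ℝ} (hr0 : 0 ≤ r)
    (hr1 : r < 1) (hf0 : ∀ k, 0 ≤ f k) (hf : ∀ k, f k ≤ C * r ^ k) :
    Summable f ∧ Summable fun k => √(f k) := by
  refine ⟨.of_nonneg_of_le hf0 hf ((summable_geometric_of_lt_one hr0 hr1).mul_left C), ?_⟩
  have hs1 : √r < 1 := by rw [Real.sqrt_lt' one_pos]; simpa
  refine .of_nonneg_of_le (fun k => Real.sqrt_nonneg _) (fun k => ?_)
    ((summable_geometric_of_lt_one (Real.sqrt_nonneg r) hs1).mul_left √C)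
  have hpow : √(r ^ k) = √r ^ k := by
    rw [Real.sqrt_eq_iff_eq_sq (by positivity) (by positivity), ← pow_mul, mul_comm, pow_mul,
      Real.sq_sqrt hr0]
  rw [← hpow, ← Real.sqrt_mul' C (by positivity)]
  exact Real.sqrt_le_sqrt (hf k)

theorem stmt_9
    (n m : ℕ) (hn : 0 < n) (hm : 1 ≤ m)
    (g : Fin m → EuclideanSpace ℝ (Fin n) → ℝ)
    (G : Fin m → EuclideanSpace ℝ (Fin n) → EuclideanSpace ℝ (Fin n))
    (L Gg Gh α : ℝ) (hL : 0 < L)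
    (hgrad : ∀ i x, HasGradientAt (g i) (G i x) x)
    (hLip : ∀ i x y, ‖G i x - G i y‖ ≤ L * ‖x - y‖)
    (hGg : ∀ i x, ‖G i x‖ ≤ Gg)
    (h : EuclideanSpace ℝ (Fin n) → ℝ)
    (hconv : ConvexOn ℝ Set.univ h)
    (hGh : 0 < Gh)
    (hsub : ∀ x z : EuclideanSpace ℝ (Fin n), (∀ u, h x + ⟪z, u - x⟫ ≤ h u) → ‖z‖ ≤ Gh)
    (hα0 : 0 < α) (hα1 : α < 1 / L)
    (prox : EuclideanSpace ℝ (Fin n) → EuclideanSpace ℝ (Fin n))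
    (hprox : ∀ w z, h (prox w) + (1 / (2 * α)) * ‖prox w - w‖ ^ 2
      ≤ h z + (1 / (2 * α)) * ‖z - w‖ ^ 2)
    (hproxuniq : ∀ w z, (∀ u, h z + (1 / (2 * α)) * ‖z - w‖ ^ 2
      ≤ h u + (1 / (2 * α)) * ‖u - w‖ ^ 2) → z = prox w)
    (lam : ℕ → Fin m → Fin m → ℝ) (Γ γ : ℝ) (hΓ : 0 < Γ) (hγ0 : 0 < γ) (hγ1 : γ < 1)
    (hlamnn : ∀ k, 2 ≤ k → ∀ i j, 0 ≤ lam k i j)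
    (hrow : ∀ k, 2 ≤ k → ∀ i, ∑ j, lam k i j = 1)
    (hcol : ∀ k, 2 ≤ k → ∀ j, ∑ i, lam k i j = 1)
    (hmix : ∀ k, 2 ≤ k → ∀ i j, |lam k i j - 1 / (m : ℝ)| ≤ Γ * γ ^ k)
    (x q v : ℕ → Fin m → EuclideanSpace ℝ (Fin n))
    (hq : ∀ k, 1 ≤ k → ∀ i, q (k + 1) i = x k i - α • G i (x k i))
    (hv : ∀ k, 1 ≤ k → ∀ i, v (k + 1) i = ∑ j, lam (k + 1) i j • q (k + 1) j)
    (hx : ∀ k, 1 ≤ k → ∀ i, x (k + 1) i = prox (v (k + 1) i))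
    (xbar : ℕ → EuclideanSpace ℝ (Fin n))
    (hxbar : ∀ k, xbar k = (m : ℝ)⁻¹ • ∑ i, x k i)
    (vbar zb : ℕ → EuclideanSpace ℝ (Fin n))
    (hvbar : ∀ k, vbar k = (m : ℝ)⁻¹ • ∑ i, v k i)
    (hzb : ∀ k, zb k = prox (vbar k))
    (gradg : EuclideanSpace ℝ (Fin n) → EuclideanSpace ℝ (Fin n))
    (hgradg : ∀ y, gradg y = (m : ℝ)⁻¹ • ∑ i, G i y)
    (e : ℕ → EuclideanSpace ℝ (Fin n))
    (he : ∀ k, 1 ≤ k → e (k + 1) = (m : ℝ)⁻¹ • ∑ i, (G i (x k i) - G i (xbar k)))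
    (eps : ℕ → ℝ)
    (heps : ∀ k, 1 ≤ k → eps (k + 1) =
      ‖xbar (k + 1) - zb (k + 1)‖ * (Gh + α⁻¹ * ‖zb (k + 1) - vbar (k + 1)‖)
        + (1 / (2 * α)) * ‖xbar (k + 1) - zb (k + 1)‖ ^ 2)
    :
    Summable (fun k : ℕ => ‖e (k + 2)‖) ∧
    Summable (fun k : ℕ => eps (k + 2)) ∧
    Summable (fun k : ℕ => Real.sqrt (eps (k + 2))) := by
  have hsubgrad : ∀ w u, h (prox w) + ⟪α⁻¹ • (w - prox w), u - prox w⟫ ≤ h u :=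
    fun w => subgradient_of_prox_minimizer hconv (hprox w)
  have hdist : ∀ w, ‖prox w - w‖ ≤ α * Gh := fun w => by
    have := hsub _ _ (hsubgrad w)
    rwa [norm_smul, norm_inv, Real.norm_of_nonneg hα0.le, inv_mul_le_iff₀ hα0,
      norm_sub_rev] at this
  have hnonexp : ∀ w w', ‖prox w - prox w'‖ ≤ ‖w - w'‖ := fun w w' =>
    norm_sub_le_of_subgradient hα0 (hsubgrad w) (hsubgrad w')
  set M := ∑ j, ‖x 1 j‖
  have hqx : ∀ k i, ‖q (k + 2) i‖ ≤ ‖x (k + 1) i‖ + α * Gg := fun k i => by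
    rw [hq (k + 1) (by omega)]
    refine (norm_sub_le _ _).trans (add_le_add_right ?_ _)
    rw [norm_smul, Real.norm_of_nonneg hα0.le]
    exact mul_le_mul_of_nonneg_left (hGg _ _) hα0.le
  have hxbound : ∀ (k : ℕ) i, ‖x (k + 1) i‖ ≤ M + k * (α * (Gg + Gh)) := by
    intro k
    induction k with
    | zero =>
      intro i
      simpa using Finset.single_le_sum (f := fun j => ‖x 1 j‖)
        (fun j _ => norm_nonneg _) (Finset.mem_univ i)
    | succ k ih =>
      intro i
      have hvb : ‖v (k + 2) i‖ ≤ M + k * (α * (Gg + Gh)) + α * Gg := by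
        rw [hv (k + 1) (by omega)]
        exact norm_weighted_sum_le (hlamnn _ (by omega) i) (hrow _ (by omega) i) fun j =>
          (hqx k j).trans (by linarith [ih j])
      have htri := norm_le_norm_add_norm_sub' (prox (v (k + 2) i)) (v (k + 2) i)
      rw [hx (k + 1) (by omega)]
      push_cast
      linarith [hdist (v (k + 2) i)]
  obtain ⟨C₀, r, hC₀, hr0, hr1, hgeo⟩ :=
    exists_geometric_bound (M + α * Gg) (α * (Gg + Gh)) hγ0 hγ1
  obtain ⟨C, hC, hvdev⟩ : ∃ C : ℝ, 0 ≤ C ∧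
      ∀ k i, ‖v (k + 2) i - vbar (k + 2)‖ ≤ C * r ^ k := by
    refine ⟨m * Γ * γ ^ 2 * C₀, by positivity, fun k i => ?_⟩
    have hmixed := norm_mix_sub_average_le (hcol (k + 2) (by omega)) (hmix (k + 2) (by omega))
      (y := q (k + 2)) (d := M + α * Gg + k * (α * (Gg + Gh)))
      (fun j => (hqx k j).trans (by linarith [hxbound k j])) i
    rw [hvbar]
    simp_rw [hv (k + 1) (by omega)]
    refine hmixed.trans ?_
    calc m * (Γ * γ ^ (k + 2) * (M + α * Gg + k * (α * (Gg + Gh))))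
        = m * Γ * γ ^ 2 * (γ ^ k * (M + α * Gg + k * (α * (Gg + Gh)))) := by ring
      _ ≤ m * Γ * γ ^ 2 * (C₀ * r ^ k) := mul_le_mul_of_nonneg_left (hgeo k) (by positivity)
      _ = m * Γ * γ ^ 2 * C₀ * r ^ k := by ring
  have hxz : ∀ k i, ‖x (k + 2) i - zb (k + 2)‖ ≤ C * r ^ k := fun k i => by
    rw [hx (k + 1) (by omega), hzb]
    exact (hnonexp _ _).trans (hvdev k i)
  have hxbarz : ∀ k, ‖xbar (k + 2) - zb (k + 2)‖ ≤ C * r ^ k := fun k => by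
    rw [hxbar, inv_smul_sum_sub hm]
    exact norm_inv_smul_sum_le hm (hxz k)
  refine ⟨?_, ?_⟩
  · rw [← summable_nat_add_iff 1]
    refine .of_nonneg_of_le (fun k => norm_nonneg _) (fun k => ?_)
      ((summable_geometric_of_lt_one hr0.le hr1).mul_left (L * (2 * C)))
    rw [show k + 1 + 2 = k + 2 + 1 by ring, he (k + 2) (by omega)]
    refine norm_inv_smul_sum_le hm fun i => (hLip i _ _).trans ?_
    rw [mul_assoc]
    refine mul_le_mul_of_nonneg_left ?_ hL.le
    have htri := norm_sub_le_norm_sub_add_norm_sub (x (k + 2) i) (zb (k + 2)) (xbar (k + 2))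
    rw [norm_sub_rev (zb (k + 2))] at htri
    linarith [hxz k i, hxbarz k]
  · refine summable_and_summable_sqrt_of_le_geometric (C := C * (2 * Gh) + 1 / (2 * α) * C ^ 2)
      hr0.le hr1 (fun k => ?_) fun k => ?_
    · rw [heps (k + 1) (by omega)]
      positivity
    · rw [heps (k + 1) (by omega)]
      have hzv : Gh + α⁻¹ * ‖zb (k + 2) - vbar (k + 2)‖ ≤ 2 * Gh := by
        have hz := hdist (vbar (k + 2))
        rw [← hzb, ← inv_mul_le_iff₀ hα0] at hz
        linarith
      have hpow : (r ^ k) ^ 2 ≤ r ^ k :=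
        pow_le_of_le_one (by positivity) (pow_le_one₀ hr0.le hr1.le) two_ne_zero
      calc ‖xbar (k + 2) - zb (k + 2)‖ * (Gh + α⁻¹ * ‖zb (k + 2) - vbar (k + 2)‖)
            + 1 / (2 * α) * ‖xbar (k + 2) - zb (k + 2)‖ ^ 2
          ≤ C * r ^ k * (2 * Gh) + 1 / (2 * α) * (C * r ^ k) ^ 2 := by
            gcongr
            exacts [hxbarz k, hxbarz k]
        _ = C * (2 * Gh) * r ^ k + 1 / (2 * α) * C ^ 2 * (r ^ k) ^ 2 := by ring
        _ ≤ C * (2 * Gh) * r ^ k + 1 / (2 * α) * C ^ 2 * r ^ k := by gcongr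
        _ = (C * (2 * Gh) + 1 / (2 * α) * C ^ 2) * r ^ k := by ring
end
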